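/- For disjoint finite sets X, Y ⊆ ℕ, the identity ⟨X ∪ Y⟩ - ⟨X⟩⟨Y⟩ = Σ_{I ∈ P_c(X,Y)} Π_{l=1}^k ⟨I_l⟩^T holds, where P_c(X,Y) is the set of partitions I = {I_1,…,I_k} of X ∪ Y such that no proper nonempty sub-collection of blocks has union equal to X (equivalently, to Y). -/

import Mathlib

open scoped BigOperators

/-- The finset of all partitions of a finite set `J`. -/
def partitionsOf {α : Type*} [DecidableEq α] (J : Finset α) : Finset (Finset (Finset α)) :=
  J.powerset.powerset.filter
    (fun P => ∅ ∉ P ∧ (∀ a ∈ P, ∀ b ∈ P, a ≠ b → a ∩ b = ∅) ∧ P.biUnion id = J)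

theorem mem_partitionsOf_iff (J : Finset ℕ) (P : Finset (Finset ℕ)) :
    P ∈ partitionsOf J ↔ (∀ a ∈ P, a.Nonempty) ∧
      (∀ a ∈ P, ∀ b ∈ P, ∀ x, x ∈ a → x ∈ b → a = b) ∧
      (∀ a ∈ P, ∀ x ∈ a, x ∈ J) ∧ (∀ x ∈ J, ∃ b ∈ P, x ∈ b) := by
  unfold partitionsOf
  simp only [Finset.mem_filter, Finset.mem_powerset]
  constructor
  · rintro ⟨_, h0, hd, hu⟩
    refine ⟨?_, ?_, ?_, ?_⟩
    · intro a ha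
      rw [Finset.nonempty_iff_ne_empty]
      rintro rfl
      exact h0 ha
    · intro a ha b hb x hxa hxb
      by_contra hne
      have := hd a ha b hb hne
      have hx : x ∈ a ∩ b := Finset.mem_inter.2 ⟨hxa, hxb⟩
      rw [this] at hx
      simp at hx
    · intro a ha x hx
      rw [← hu]
      exact Finset.mem_biUnion.2 ⟨a, ha, hx⟩
    · intro x hx
      rw [← hu] at hx
      simpa using hx
  · rintro ⟨hn, hd, hs, hc⟩
    refine ⟨?_, ?_, ?_, ?_⟩
    · intro a ha
      exact Finset.mem_powerset.2 (hs a ha)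
    · intro h
      simpa using hn _ h
    · intro a ha b hb hne
      ext x
      simp only [Finset.mem_inter, Finset.notMem_empty, iff_false]
      exact fun h => hne (hd a ha b hb x h.1 h.2)
    · ext x
      simp only [Finset.mem_biUnion, id]
      exact ⟨fun ⟨a, ha, hx⟩ => hs a ha x hx, hc x⟩

theorem eq_of_filter_aux {X Y : Finset ℕ} (hd : ∀ x ∈ X, x ∉ Y) {A B : Finset (Finset ℕ)}
    (hA : A ∈ partitionsOf X) (hB : B ∈ partitionsOf Y) :
    (A ∪ B).filter (· ⊆ X) = A ∧ (A ∪ B).filter (· ⊆ Y) = B := by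
  rw [mem_partitionsOf_iff] at hA hB
  obtain ⟨hA1, hA2, hA3, hA4⟩ := hA
  obtain ⟨hB1, hB2, hB3, hB4⟩ := hB
  constructor
  · ext a
    simp only [Finset.mem_filter, Finset.mem_union]
    constructor
    · rintro ⟨h | h, hs⟩
      · exact h
      · obtain ⟨x, hx⟩ := hB1 a h
        exact absurd (hB3 a h x hx) (hd x (hs hx))
    · exact fun h => ⟨Or.inl h, hA3 a h⟩
  · ext a
    simp only [Finset.mem_filter, Finset.mem_union]
    constructor
    · rintro ⟨h | h, hs⟩
      · obtain ⟨x, hx⟩ := hA1 a h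
        exact absurd (hs hx) (hd x (hA3 a h x hx))
      · exact h
    · exact fun h => ⟨Or.inr h, hB3 a h⟩

/-- Disconnected partitions split into blocks inside `X` and blocks inside `Y`. -/
theorem split_aux {X Y : Finset ℕ} (hd : ∀ x ∈ X, x ∉ Y) {P S : Finset (Finset ℕ)}
    (hP : P ∈ partitionsOf (X ∪ Y)) (hS : S ⊆ P) (hSX : S.biUnion id = X) :
    P.filter (· ⊆ X) ∈ partitionsOf X ∧ P.filter (· ⊆ Y) ∈ partitionsOf Y ∧
      P.filter (· ⊆ X) ∪ P.filter (· ⊆ Y) = P := by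
  simp only [mem_partitionsOf_iff] at hP ⊢
  obtain ⟨h1, h2, h3, h4⟩ := hP
  have hXc : ∀ x ∈ X, ∃ b ∈ S, x ∈ b := by
    intro x hx
    rw [← hSX] at hx
    simpa using hx
  have hSs : ∀ b ∈ S, b ⊆ X := by
    intro b hb x hx
    rw [← hSX]
    exact Finset.mem_biUnion.2 ⟨b, hb, hx⟩
  have key : ∀ a ∈ P, a ⊆ X ∨ a ⊆ Y := by
    intro a ha
    by_cases hS' : a ∈ S
    · exact Or.inl (hSs a hS')
    · right
      intro x hx
      rcases Finset.mem_union.1 (h3 a ha x hx) with h | h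
      · obtain ⟨b, hb, hxb⟩ := hXc x h
        have := h2 a ha b (hS hb) x hx hxb
        subst this
        exact absurd hb hS'
      · exact h
  refine ⟨⟨?_, ?_, ?_, ?_⟩, ⟨?_, ?_, ?_, ?_⟩, ?_⟩
  · exact fun a ha => h1 a (Finset.mem_filter.1 ha).1
  · exact fun a ha b hb => h2 a (Finset.mem_filter.1 ha).1 b (Finset.mem_filter.1 hb).1
  · exact fun a ha x hx => (Finset.mem_filter.1 ha).2 hx
  · intro x hx
    obtain ⟨b, hb, hxb⟩ := hXc x hx
    exact ⟨b, Finset.mem_filter.2 ⟨hS hb, hSs b hb⟩, hxb⟩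
  · exact fun a ha => h1 a (Finset.mem_filter.1 ha).1
  · exact fun a ha b hb => h2 a (Finset.mem_filter.1 ha).1 b (Finset.mem_filter.1 hb).1
  · exact fun a ha x hx => (Finset.mem_filter.1 ha).2 hx
  · intro x hx
    obtain ⟨b, hb, hxb⟩ := h4 x (Finset.mem_union_right _ hx)
    refine ⟨b, Finset.mem_filter.2 ⟨hb, ?_⟩, hxb⟩
    rcases key b hb with h | h
    · exact absurd hx (hd x (h hxb))
    · exact h
  · ext a
    simp only [Finset.mem_union, Finset.mem_filter]
    constructor
    · rintro (h | h) <;> exact h.1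
    · intro ha
      rcases key a ha with h | h
      · exact Or.inl ⟨ha, h⟩
      · exact Or.inr ⟨ha, h⟩

theorem union_mem_aux {X Y : Finset ℕ} (hd : ∀ x ∈ X, x ∉ Y) {A B : Finset (Finset ℕ)}
    (hX : X.Nonempty) (hY : Y.Nonempty)
    (hA : A ∈ partitionsOf X) (hB : B ∈ partitionsOf Y) :
    Disjoint A B ∧ A ∪ B ∈ partitionsOf (X ∪ Y) ∧
      A.Nonempty ∧ A ≠ A ∪ B ∧ A.biUnion id = X := by
  have hA' := hA
  rw [mem_partitionsOf_iff] at hA hB ⊢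
  obtain ⟨hA1, hA2, hA3, hA4⟩ := hA
  obtain ⟨hB1, hB2, hB3, hB4⟩ := hB
  have hdis : Disjoint A B := by
    rw [Finset.disjoint_left]
    intro a ha hb
    obtain ⟨x, hx⟩ := hA1 a ha
    exact hd x (hA3 a ha x hx) (hB3 a hb x hx)
  refine ⟨hdis, ⟨?_, ?_, ?_, ?_⟩, ?_, ?_, ?_⟩
  · intro a ha
    rcases Finset.mem_union.1 ha with h | h
    · exact hA1 a h
    · exact hB1 a h
  · intro a ha b hb x hxa hxb
    rcases Finset.mem_union.1 ha with h | h <;> rcases Finset.mem_union.1 hb with h' | h'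
    · exact hA2 a h b h' x hxa hxb
    · exact absurd (hB3 b h' x hxb) (hd x (hA3 a h x hxa))
    · exact absurd (hB3 a h x hxa) (hd x (hA3 b h' x hxb))
    · exact hB2 a h b h' x hxa hxb
  · intro a ha x hx
    rcases Finset.mem_union.1 ha with h | h
    · exact Finset.mem_union_left _ (hA3 a h x hx)
    · exact Finset.mem_union_right _ (hB3 a h x hx)
  · intro x hx
    rcases Finset.mem_union.1 hx with h | h
    · obtain ⟨b, hb, hxb⟩ := hA4 x h
      exact ⟨b, Finset.mem_union_left _ hb, hxb⟩
    · obtain ⟨b, hb, hxb⟩ := hB4 x h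
      exact ⟨b, Finset.mem_union_right _ hb, hxb⟩
  · obtain ⟨x, hx⟩ := hX
    obtain ⟨b, hb, _⟩ := hA4 x hx
    exact ⟨b, hb⟩
  · intro h
    obtain ⟨y, hy⟩ := hY
    obtain ⟨b, hb, _⟩ := hB4 y hy
    have hbA : b ∈ A := by
      rw [h]
      exact Finset.mem_union_right _ hb
    exact Finset.disjoint_left.1 hdis hbA hb
  · unfold partitionsOf at hA'
    exact (Finset.mem_filter.1 hA').2.2.2

/-- For disjoint nonempty finite sets `X, Y`, the difference
`⟨X ∪ Y⟩ - ⟨X⟩⟨Y⟩` equals the sum over partitions of `X ∪ Y` connected with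
respect to the pair `(X, Y)` (no proper nonempty sub-collection of blocks has
union equal to `X`) of the products of truncated moments over the blocks. -/
theorem cluster_difference_eq_sum_connected (m T : Finset ℕ → ℝ)
    (hT : ∀ J : Finset ℕ, J.Nonempty → m J = ∑ P ∈ partitionsOf J, ∏ b ∈ P, T b)
    (X Y : Finset ℕ) (hX : X.Nonempty) (hY : Y.Nonempty) (hdisj : X ∩ Y = ∅) :
    m (X ∪ Y) - m X * m Y =
      ∑ P ∈ (partitionsOf (X ∪ Y)).filter
          (fun P => ¬ ∃ S ∈ P.powerset, S.Nonempty ∧ S ≠ P ∧ S.biUnion id = X),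
        ∏ b ∈ P, T b := by
  have hd : ∀ x ∈ X, x ∉ Y := by
    intro x hx hy
    have h : x ∈ X ∩ Y := Finset.mem_inter.2 ⟨hx, hy⟩
    rw [hdisj] at h
    simp at h
  have hXY : (X ∪ Y).Nonempty := hX.mono Finset.subset_union_left
  rw [hT _ hXY, hT X hX, hT Y hY, Finset.sum_mul_sum, ← Finset.sum_product',
    ← Finset.sum_filter_add_sum_filter_not (partitionsOf (X ∪ Y))
      (fun P => ∃ S ∈ P.powerset, S.Nonempty ∧ S ≠ P ∧ S.biUnion id = X)]
  rw [sub_eq_iff_eq_add, add_comm]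
  congr 1
  symm
  refine Finset.sum_nbij' (fun p => p.1 ∪ p.2)
    (fun P => (P.filter (· ⊆ X), P.filter (· ⊆ Y))) ?_ ?_ ?_ ?_ ?_
  · rintro ⟨A, B⟩ h
    obtain ⟨hA, hB⟩ := Finset.mem_product.1 h
    obtain ⟨_, h2, h3, h4, h5⟩ := union_mem_aux hd hX hY hA hB
    exact Finset.mem_filter.2 ⟨h2, A, Finset.mem_powerset.2 Finset.subset_union_left, h3, h4, h5⟩
  · intro P h
    obtain ⟨hP, S, hS, _, _, hSX⟩ := Finset.mem_filter.1 h
    obtain ⟨h1, h2, _⟩ := split_aux hd hP (Finset.mem_powerset.1 hS) hSX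
    exact Finset.mem_product.2 ⟨h1, h2⟩
  · rintro ⟨A, B⟩ h
    obtain ⟨hA, hB⟩ := Finset.mem_product.1 h
    obtain ⟨h1, h2⟩ := eq_of_filter_aux hd hA hB
    exact Prod.ext h1 h2
  · intro P h
    obtain ⟨hP, S, hS, _, _, hSX⟩ := Finset.mem_filter.1 h
    exact (split_aux hd hP (Finset.mem_powerset.1 hS) hSX).2.2
  · rintro ⟨A, B⟩ h
    obtain ⟨hA, hB⟩ := Finset.mem_product.1 h
    exact (Finset.prod_union (union_mem_aux hd hX hY hA hB).1).symm
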